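/- arXiv:1604.07083 — 2 statements merged into one kernel-verified Lean document; each statement's English description precedes it below -/
import Mathlib

section
/- Let (X, d) be a metric space, let C ⊆ X be a nonempty compact set, let B ⊆ X be a nonempty closed set, and let A : X → ℝ be a continuous function with A(q) ≥ 0 for all q ∈ C. Suppose p ∈ C satisfies infDist(p, B) · A(p) > 0, and that infDist(q, B) ≤ infDist(p, B) for every q ∈ C. Then there exists q₀ ∈ C such that: (i) infDist(q₀, B) > 0; (ii) A(q₀) ≥ A(p); and (iii) for every q ∈ C with d(q, q₀) ≤ infDist(q₀, B)/2 one has infDist(q₀, B) ≤ 2 · infDist(q, B) and A(q) ≤ 2 · A(q₀). -/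
/-- Point-picking (blow-up) selection argument: in a metric space, given a nonempty
compact set `C`, a nonempty closed set `B`, and a continuous nonnegative function `A`
on `C`, if `p ∈ C` satisfies `infDist p B * A p > 0` and `p` maximizes `infDist · B`
on `C`, then there is `q₀ ∈ C` with `infDist q₀ B > 0`, `A q₀ ≥ A p`, and the doubling
property on the half-ball around `q₀`. -/
theorem point_picking {X : Type*} [MetricSpace X] (C B : Set X)
    (hC : IsCompact C) (hCne : C.Nonempty) (hB : IsClosed B) (hBne : B.Nonempty)
    (A : X → ℝ) (hA : Continuous A) (hA0 : ∀ q ∈ C, 0 ≤ A q)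
    (p : X) (hp : p ∈ C) (hpos : 0 < Metric.infDist p B * A p)
    (hmax : ∀ q ∈ C, Metric.infDist q B ≤ Metric.infDist p B) :
    ∃ q₀ ∈ C, 0 < Metric.infDist q₀ B ∧ A p ≤ A q₀ ∧
      ∀ q ∈ C, dist q q₀ ≤ Metric.infDist q₀ B / 2 →
        Metric.infDist q₀ B ≤ 2 * Metric.infDist q B ∧ A q ≤ 2 * A q₀ := by
  obtain ⟨q₀, hq₀, hq₀max⟩ := hC.exists_isMaxOn hCne
    ((Metric.continuous_infDist_pt B).mul hA).continuousOn
  have hle : ∀ q ∈ C, Metric.infDist q B * A q ≤ Metric.infDist q₀ B * A q₀ :=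
    fun q hq => hq₀max hq
  have hprod : 0 < Metric.infDist q₀ B * A q₀ := hpos.trans_le (hle p hp)
  have hdist : 0 < Metric.infDist q₀ B := pos_of_mul_pos_left hprod (hA0 q₀ hq₀)
  have hdist_p : 0 < Metric.infDist p B := pos_of_mul_pos_left hpos (hA0 p hp)
  refine ⟨q₀, hq₀, hdist, ?_, fun q hq hqq₀ => ?_⟩
  · refine le_of_mul_le_mul_left ((hle p hp).trans ?_) hdist_p
    exact mul_le_mul_of_nonneg_right (hmax q₀ hq₀) (hA0 q₀ hq₀)
  · have htri : Metric.infDist q₀ B ≤ Metric.infDist q B + dist q₀ q :=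
      Metric.infDist_le_infDist_add_dist
    rw [dist_comm] at htri
    have hhalf : Metric.infDist q₀ B ≤ 2 * Metric.infDist q B := by linarith
    refine ⟨hhalf, le_of_mul_le_mul_left ?_ hdist⟩
    have hmul := mul_le_mul_of_nonneg_right hhalf (hA0 q hq)
    linarith [hle q hq]
end

section
/- Let f : ℝ → ℝ be continuous on [0,1] with f(0) < 0 and f(1) > 0. Let Z = {x ∈ [0,1] : f(x) = 0} and assume Z is finite and that every zero is a strict sign change, i.e. for each z ∈ Z there exists ε > 0 such that either (f < 0 on (z−ε, z) ∩ [0,1] and f > 0 on (z, z+ε) ∩ [0,1]) or (f > 0 on (z−ε, z) ∩ [0,1] and f < 0 on (z, z+ε) ∩ [0,1]). Then the cardinality of Z is odd. -/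
/-- A continuous function without zeros on `[a, b]` has the same sign at both endpoints. -/
theorem ContinuousOn.pos_iff_pos_of_ne_zero {f : ℝ → ℝ} {a b : ℝ} (hab : a ≤ b)
    (hf : ContinuousOn f (Set.Icc a b)) (hne : ∀ x ∈ Set.Icc a b, f x ≠ 0) :
    0 < f a ↔ 0 < f b := by
  have ha := hne a (Set.left_mem_Icc.2 hab)
  have hb := hne b (Set.right_mem_Icc.2 hab)
  constructor
  · intro h
    by_contra h'
    obtain ⟨x, hx, hx0⟩ := intermediate_value_Icc' hab hf ⟨not_lt.1 h', h.le⟩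
    exact hne x hx hx0
  · intro h
    by_contra h'
    obtain ⟨x, hx, hx0⟩ := intermediate_value_Icc hab hf ⟨not_lt.1 h', h.le⟩
    exact hne x hx hx0

/-- If all zeros in `[0, 1]` are strict sign changes, then the parity of the number of zeros
before a point `b` with `f b ≠ 0` determines the sign of `f b`. -/
theorem odd_ncard_zeros_lt_iff_pos {f : ℝ → ℝ}
    (hf : ContinuousOn f (Set.Icc 0 1)) (h0 : f 0 < 0)
    {Z : Set ℝ} (hZ : Z = {x ∈ Set.Icc (0:ℝ) 1 | f x = 0}) (hfin : Z.Finite)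
    (hsign : ∀ z ∈ Z, ∃ ε > 0,
      ((∀ x ∈ Set.Ioo (z - ε) z ∩ Set.Icc 0 1, f x < 0) ∧
        (∀ x ∈ Set.Ioo z (z + ε) ∩ Set.Icc 0 1, 0 < f x)) ∨
      ((∀ x ∈ Set.Ioo (z - ε) z ∩ Set.Icc 0 1, 0 < f x) ∧
        (∀ x ∈ Set.Ioo z (z + ε) ∩ Set.Icc 0 1, f x < 0)))
    (n : ℕ) {b : ℝ} (hb : b ∈ Set.Icc (0:ℝ) 1) (hfb : f b ≠ 0)
    (hn : (Z ∩ Set.Iio b).ncard = n) : Odd n ↔ 0 < f b := by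
  have mem_Z : ∀ x, x ∈ Z ↔ (0 ≤ x ∧ x ≤ 1) ∧ f x = 0 := fun x => by
    rw [hZ]; rfl
  have same_sign : ∀ a c, 0 ≤ a → a ≤ c → c ≤ 1 → (∀ x ∈ Set.Icc a c, x ∉ Z) →
      (0 < f a ↔ 0 < f c) := fun a c ha hac hc h =>
    (hf.mono (Set.Icc_subset_Icc ha hc)).pos_iff_pos_of_ne_zero hac fun x hx hx0 =>
      h x hx ((mem_Z x).2 ⟨⟨ha.trans hx.1, hx.2.trans hc⟩, hx0⟩)
  have hbZ : b ∉ Z := fun h => hfb ((mem_Z b).1 h).2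
  induction n generalizing b with
  | zero =>
    have hempty := (Set.ncard_eq_zero (hfin.inter_of_left _)).1 hn
    have := same_sign 0 b le_rfl hb.1 hb.2 fun x hx hxZ => by
      rcases hx.2.eq_or_lt with rfl | hxb
      · exact hbZ hxZ
      · exact Set.eq_empty_iff_forall_notMem.1 hempty x ⟨hxZ, hxb⟩
    simp [← this, h0.le]
  | succ n ih =>
    have hne : (Z ∩ Set.Iio b).Nonempty :=
      (Set.ncard_pos (hfin.inter_of_left _)).1 (by omega)
    obtain ⟨z, ⟨hzZ, hzb⟩, hmax⟩ :=
      Set.exists_max_image _ id (hfin.inter_of_left (Set.Iio b)) hne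
    simp only [id, Set.mem_Iio] at hmax hzb
    obtain ⟨⟨hz0, hz1⟩, hfz⟩ := (mem_Z z).1 hzZ
    have hzpos : 0 < z := hz0.lt_of_ne (by rintro rfl; exact h0.ne hfz)
    obtain ⟨ε, hε, hs⟩ := hsign z hzZ
    obtain ⟨c, hc, hcz⟩ := exists_between (max_lt (sub_lt_self z hε) hzpos)
    obtain ⟨d, hzd, hd⟩ := exists_between (lt_min (lt_add_of_pos_right z hε) hzb)
    rw [max_lt_iff] at hc
    rw [lt_min_iff] at hd
    have hb1 := hb.2
    have hcI : c ∈ Set.Icc (0:ℝ) 1 := ⟨hc.2.le, by linarith⟩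
    have hdI : d ∈ Set.Icc (0:ℝ) 1 := ⟨by linarith, by linarith⟩
    have hleft : ∀ x ∈ Set.Ico c z, x ∉ Z := fun x hx hxZ => by
      obtain ⟨hxI, hx0⟩ := (mem_Z x).1 hxZ
      have hxm : x ∈ Set.Ioo (z - ε) z ∩ Set.Icc 0 1 := ⟨⟨hc.1.trans_le hx.1, hx.2⟩, hxI⟩
      rcases hs with hs | hs
      · exact (hs.1 x hxm).ne hx0
      · exact (hs.1 x hxm).ne' hx0
    have hcZ : c ∉ Z := hleft c ⟨le_rfl, hcz⟩
    have hset : Z ∩ Set.Iio b = insert z (Z ∩ Set.Iio c) := by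
      ext x
      simp only [Set.mem_inter_iff, Set.mem_Iio, Set.mem_insert_iff]
      constructor
      · rintro ⟨hxZ, hxb⟩
        rcases (hmax x ⟨hxZ, hxb⟩).eq_or_lt with h | h
        · exact Or.inl h
        · exact Or.inr ⟨hxZ, not_le.1 fun hcx => hleft x ⟨hcx, h⟩ hxZ⟩
      · rintro (rfl | ⟨hxZ, hxc⟩)
        · exact ⟨hzZ, hzb⟩
        · exact ⟨hxZ, by linarith⟩
    have hzc : z ∉ Z ∩ Set.Iio c := fun h => hcz.not_gt h.2
    have hcard : (Z ∩ Set.Iio c).ncard = n := by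
      rw [hset, Set.ncard_insert_of_notMem hzc
        (hfin.inter_of_left _)] at hn
      omega
    have hodd : Odd n ↔ 0 < f c := ih hcI (fun h => hcZ ((mem_Z c).2 ⟨hcI, h⟩)) hcard hcZ
    have hdb := same_sign d b hdI.1 hd.2.le hb1 fun x hx hxZ => by
      rcases hx.2.eq_or_lt with rfl | hxb
      · exact hbZ hxZ
      · exact absurd (hmax x ⟨hxZ, hxb⟩) (not_le.2 (hzd.trans_le hx.1))
    have hflip : 0 < f d ↔ ¬ 0 < f c := by
      have hcm : c ∈ Set.Ioo (z - ε) z ∩ Set.Icc 0 1 := ⟨⟨hc.1, hcz⟩, hcI⟩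
      have hdm : d ∈ Set.Ioo z (z + ε) ∩ Set.Icc 0 1 := ⟨⟨hzd, hd.1⟩, hdI⟩
      rcases hs with hs | hs
      · exact iff_of_true (hs.2 d hdm) (hs.1 c hcm).not_gt
      · exact iff_of_false (hs.2 d hdm).not_gt (not_not.2 (hs.1 c hcm))
    rw [← hdb, hflip, ← hodd, Nat.odd_add_one]

/-- Parity argument: a continuous function on `[0,1]` which is negative at `0`,
positive at `1`, and has finitely many zeros, each being a strict sign change,
has an odd number of zeros. -/
theorem odd_number_of_sign_changes (f : ℝ → ℝ)
    (hf : ContinuousOn f (Set.Icc 0 1)) (h0 : f 0 < 0) (h1 : 0 < f 1)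
    (Z : Set ℝ) (hZ : Z = {x ∈ Set.Icc (0:ℝ) 1 | f x = 0}) (hfin : Z.Finite)
    (hsign : ∀ z ∈ Z, ∃ ε > 0,
      ((∀ x ∈ Set.Ioo (z - ε) z ∩ Set.Icc 0 1, f x < 0) ∧
        (∀ x ∈ Set.Ioo z (z + ε) ∩ Set.Icc 0 1, 0 < f x)) ∨
      ((∀ x ∈ Set.Ioo (z - ε) z ∩ Set.Icc 0 1, 0 < f x) ∧
        (∀ x ∈ Set.Ioo z (z + ε) ∩ Set.Icc 0 1, f x < 0))) :
    Odd Z.ncard := by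
  have hZ1 : Z ∩ Set.Iio 1 = Z := Set.inter_eq_left.2 fun x hx => by
    rw [hZ] at hx
    exact hx.1.2.lt_of_ne (by rintro rfl; exact h1.ne' hx.2)
  exact (odd_ncard_zeros_lt_iff_pos hf h0 hZ hfin hsign _
    (Set.right_mem_Icc.2 zero_le_one) h1.ne' (by rw [hZ1])).2 h1
end
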